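/- arXiv:1812.03695 — 2 statements merged into one kernel-verified Lean document; each statement's English description precedes it below -/
import Mathlib

section
/- Fix N ≥ 1, real parameters λ, μ with λμ(λ−μ)(λ+μ) ≠ 0, and reals m_k, m̄_k, c_k, c̄_k (k = 1,…,N) such that m̄_j ≠ m_k and m_j ≠ m̄_k for all j,k, and m_k, m̄_k ∉ {λ,−λ,μ,−μ} for all k. Suppose det(1 + A(x,y,n₁,n₂)·Ā(x,y,n₁,n₂)) > 0 for all x,y ∈ ℝ and n₁,n₂ ∈ ℤ. Then the function u(x,y,n₁,n₂) = φ(x,y,n₁,n₂) + ln det(1 + A(x,y,n₁,n₂)·Ā(x,y,n₁,n₂)) satisfies the (2+2)-dimensional Toda lattice equation: for all x,y ∈ ℝ and n₁,n₂ ∈ ℤ, the mixed second partial derivative ∂²u/∂x∂y equals exp(Δ₁u) − exp(Δ₂u). -/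
open Matrix Real

noncomputable section

/-- `h_ζ(s) = (s-ζ)/(s+ζ)` -/
def solh (ζ s : ℝ) : ℝ := (s - ζ) / (s + ζ)

/-- `h̄_ζ(s) = (s+ζ)/(s-ζ)` -/
def solhb (ζ s : ℝ) : ℝ := (s + ζ) / (s - ζ)

/-- `l_ζ(s) = h_ζ(s) - 1/h_ζ(s)` -/
def soll (ζ s : ℝ) : ℝ := solh ζ s - 1 / solh ζ s

/-- `l̄_ζ(s) = h̄_ζ(s) - 1/h̄_ζ(s)` -/
def sollb (ζ s : ℝ) : ℝ := solhb ζ s - 1 / solhb ζ s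

/-- The matrix `A(x,y,n₁,n₂)`. -/
def solA (N : ℕ) (lam mu : ℝ) (m mb c : Fin N → ℝ) (x y : ℝ) (n₁ n₂ : ℤ) :
    Matrix (Fin N) (Fin N) ℝ :=
  Matrix.of fun j k =>
    c k / (mb j - m k) * Real.exp (x * soll lam (m k) + y * soll mu (m k)) *
      (solh lam (m k)) ^ (n₁ + n₂) * (solh mu (m k)) ^ (n₂ - n₁)

/-- The matrix `Ā(x,y,n₁,n₂)`. -/
def solAb (N : ℕ) (lam mu : ℝ) (m mb cb : Fin N → ℝ) (x y : ℝ) (n₁ n₂ : ℤ) :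
    Matrix (Fin N) (Fin N) ℝ :=
  Matrix.of fun j k =>
    cb k / (m j - mb k) * Real.exp (x * sollb lam (mb k) + y * sollb mu (mb k)) *
      (solhb lam (mb k)) ^ (n₁ + n₂) * (solhb mu (mb k)) ^ (n₂ - n₁)

/-- The background `φ(x,y,n₁,n₂)`. -/
def solPhi (lam mu : ℝ) (x y : ℝ) (n₁ n₂ : ℤ) : ℝ :=
  8 * x * y * (lam * mu * (lam ^ 2 + mu ^ 2) / (lam ^ 2 - mu ^ 2) ^ 2) +
    ((n₁ : ℝ) ^ 2 - (n₂ : ℝ) ^ 2) * Real.log |(lam + mu) / (lam - mu)|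

theorem hasDerivAt_det {n : Type*} [Fintype n] [DecidableEq n] {K : ℝ → Matrix n n ℝ}
    {K' : Matrix n n ℝ} {t : ℝ} (h : ∀ i j, HasDerivAt (fun s => K s i j) (K' i j) t) :
    HasDerivAt (fun s => (K s).det) ((K t).adjugate * K').trace t := by
  have h1 : HasDerivAt (fun s => (K s).det)
      (∑ σ : Equiv.Perm n, (Equiv.Perm.sign σ : ℝ) *
        ∑ i, (∏ j ∈ Finset.univ.erase i, K t (σ j) j) * K' (σ i) i) t := by
    simp only [det_apply']
    refine HasDerivAt.fun_sum fun σ _ => HasDerivAt.const_mul _ ?_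
    simpa [smul_eq_mul] using HasDerivAt.fun_finsetProd (u := Finset.univ)
      (f := fun i s => K s (σ i) i) (fun i _ => h (σ i) i)
  convert h1 using 1
  have h2 : ∀ i, ((K t).adjugate * K') i i = ((K t).updateCol i (fun j => K' j i)).det := by
    intro i
    rw [← cramer_apply, cramer_eq_adjugate_mulVec]
    rfl
  simp only [trace, diag_apply, h2, det_apply', Finset.mul_sum]
  rw [Finset.sum_comm]
  refine Finset.sum_congr rfl fun σ _ => Finset.sum_congr rfl fun i _ => ?_
  rw [← Finset.mul_prod_erase _ _ (Finset.mem_univ i)]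
  rw [Finset.prod_congr rfl (g := fun j => K t (σ j) j)]
  · simp; ring
  · intro j hj
    simp [Finset.ne_of_mem_erase hj]

theorem hasDerivAt_matrix_inv {n : Type*} [Fintype n] [DecidableEq n] {K : ℝ → Matrix n n ℝ}
    {K' : Matrix n n ℝ} {t : ℝ} (h : ∀ i j, HasDerivAt (fun s => K s i j) (K' i j) t)
    (hdet : ∀ s, (K s).det ≠ 0) (i j : n) :
    HasDerivAt (fun s => (K s)⁻¹ i j) (-((K t)⁻¹ * K' * (K t)⁻¹) i j) t := by
  have hdiff : ∀ i j, DifferentiableAt ℝ (fun s => (K s)⁻¹ i j) t := by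
    intro i j
    simp only [inv_def, Ring.inverse_eq_inv', Matrix.smul_apply, smul_eq_mul, adjugate_apply]
    refine ((hasDerivAt_det h).differentiableAt.inv (hdet t)).fun_mul
      (hasDerivAt_det (K := fun s => (K s).updateRow j (Pi.single i 1))
        (K' := K'.updateRow j 0) fun a b => ?_).differentiableAt
    by_cases hab : a = j
    · subst hab
      simpa using hasDerivAt_const t _
    · simpa [updateRow_apply, hab] using h a b
  set R' : Matrix n n ℝ := of fun i j => deriv (fun s => (K s)⁻¹ i j) t with hR'
  have hR : ∀ i j, HasDerivAt (fun s => (K s)⁻¹ i j) (R' i j) t :=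
    fun i j => (hdiff i j).hasDerivAt
  have hunit : ∀ s, IsUnit (K s).det := fun s => (hdet s).isUnit
  have hprod : K' * (K t)⁻¹ + K t * R' = 0 := by
    ext a b
    have h1 : HasDerivAt (fun s => (K s * (K s)⁻¹) a b) ((K' * (K t)⁻¹ + K t * R') a b) t := by
      simp only [mul_apply, Matrix.add_apply, ← Finset.sum_add_distrib]
      exact HasDerivAt.fun_sum fun c _ => (h a c).fun_mul (hR c b)
    simp only [mul_nonsing_inv _ (hunit _)] at h1
    exact h1.unique (hasDerivAt_const t _)
  have h2 : R' = -((K t)⁻¹ * K' * (K t)⁻¹) := by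
    have h3 : (K t)⁻¹ * (K' * (K t)⁻¹ + K t * R') = 0 := by rw [hprod, Matrix.mul_zero]
    rw [Matrix.mul_add, ← Matrix.mul_assoc, ← Matrix.mul_assoc, nonsing_inv_mul _ (hunit t),
      Matrix.one_mul] at h3
    exact eq_neg_of_add_eq_zero_right h3
  simpa [h2] using hR i j

theorem projector_cycle_identity {ι : Type*} {p q s t : ι → ℝ} {D : ι → ι → ℝ}
    (hD : ∀ i j, D i j = p i * s j + q i * t j) (h : ∀ i, D i i = 1) (i j k l : ι) :
    D i j * D j k * D k l * D l i + D i l * D l k * D k j * D j i =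
      D i j * D j i * (D k l * D l k) + D i l * D l i * (D j k * D k j)
        - D i k * D k i * (D j l * D l j) + D i k * D k i + D j l * D l j - 1 := by
  have key : D i j * D j k * D k l * D l i + D i l * D l k * D k j * D j i =
      D i j * D j i * (D k l * D l k) + D i l * D l i * (D j k * D k j)
        - D i k * D k i * (D j l * D l j) + D i k * D k i * (D j j * D l l)
        + D j l * D l j * (D i i * D k k) - D i i * D j j * (D k k * D l l) := by
    simp only [hD]; ring
  simpa [h] using key

theorem toda_projector_identity {ι : Type*} {p q s t : ι → ℝ} {D : ι → ι → ℝ}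
    (hD : ∀ i j, D i j = p i * s j + q i * t j) (h : ∀ i, D i i = 1) (i j k l : ι)
    {lam mu : ℝ} (h1 : lam - mu ≠ 0) (h2 : lam + mu ≠ 0) :
    4 * lam * mu * ((D i k * D k i - 1) / (lam - mu) ^ 2 + (D i l * D l i - 1) / (lam + mu) ^ 2
      + (D j k * D k j - 1) / (lam + mu) ^ 2 + (D j l * D l j - 1) / (lam - mu) ^ 2)
      + 8 * (lam * mu * (lam ^ 2 + mu ^ 2) / (lam ^ 2 - mu ^ 2) ^ 2) =
    ((lam + mu) / (lam - mu)) ^ 2 *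
      ((((lam - mu) ^ 2 * (D j i * D k l) + 4 * lam * mu * (D j l * D k i)) / (lam + mu) ^ 2) *
       (((lam - mu) ^ 2 * (D i j * D l k) + 4 * lam * mu * (D i k * D l j)) / (lam + mu) ^ 2)) -
    ((lam - mu) / (lam + mu)) ^ 2 *
      ((((lam + mu) ^ 2 * (D j i * D l k) - 4 * lam * mu * (D j k * D l i)) / (lam - mu) ^ 2) *
       (((lam + mu) ^ 2 * (D i j * D k l) - 4 * lam * mu * (D i l * D k j)) / (lam - mu) ^ 2)) := by
  have e1 := projector_cycle_identity hD h j i k l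
  have e2 := projector_cycle_identity hD h j i l k
  have h3 : lam ^ 2 - mu ^ 2 = (lam - mu) * (lam + mu) := by ring
  rw [h3]
  field_simp
  linear_combination (-4 * lam * mu * (lam - mu) ^ 2) * e1 - 4 * lam * mu * (lam + mu) ^ 2 * e2

/-- The Cauchy-like matrix with entries `a j * b k / (mb j - m k)`. -/
def cauchyLike {n : Type*} (m mb a b : n → ℝ) : Matrix n n ℝ :=
  of fun j k => a j * b k / (mb j - m k)

/-- The kernel `Ā (1 + A Ā)⁻¹`. -/
def solitonKernel {n : Type*} [Fintype n] [DecidableEq n] (A Ab : Matrix n n ℝ) : Matrix n n ℝ :=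
  Ab * (1 + A * Ab)⁻¹

/-- The pairing of the vectors `b / (m - α)` and `a / (mb - β)` through `G`. -/
def pairing {n : Type*} [Fintype n] (m mb a b : n → ℝ) (G : Matrix n n ℝ) (α β : ℝ) : ℝ :=
  ∑ k, ∑ j, b k / (m k - α) * G k j * (a j / (mb j - β))

theorem det_one_add_mul_update {n : Type*} [Fintype n] [DecidableEq n]
    {k : Type*} [Fintype k] [DecidableEq k] {A A' Ab : Matrix n n ℝ}
    (U : Matrix n k ℝ) (V : Matrix k n ℝ) (hA : A' = A + U * V) (hdet : (1 + A * Ab).det ≠ 0) :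
    (1 + A' * Ab).det = (1 + A * Ab).det * (1 + V * solitonKernel A Ab * U).det := by
  have h : 1 + A' * Ab = (1 + U * (V * solitonKernel A Ab)) * (1 + A * Ab) := by
    rw [Matrix.add_mul, solitonKernel, ← Matrix.mul_assoc V, Matrix.mul_assoc U,
      Matrix.mul_assoc (V * Ab), nonsing_inv_mul _ hdet.isUnit, hA]
    simp only [Matrix.add_mul, Matrix.one_mul, Matrix.mul_one, Matrix.mul_assoc, add_assoc]
  rw [h, det_mul, det_one_add_mul_comm U, mul_comm]

theorem det_shift {n : Type*} [Fintype n] [DecidableEq n]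
    {m mb a b : n → ℝ} {Ab : Matrix n n ℝ} {α₁ α₂ β₁ β₂ : ℝ}
    (hdet : (1 + cauchyLike m mb a b * Ab).det ≠ 0) (hne : ∀ j k, mb j ≠ m k)
    (hα : α₁ ≠ α₂) (hβ : β₁ ≠ β₂) (h11 : β₁ ≠ α₁) (h12 : β₁ ≠ α₂) (h21 : β₂ ≠ α₁)
    (h22 : β₂ ≠ α₂) (hm : ∀ k, m k ≠ β₁ ∧ m k ≠ β₂)
    (hmb : ∀ k, mb k ≠ α₁ ∧ mb k ≠ α₂ ∧ mb k ≠ β₁ ∧ mb k ≠ β₂) {a' b' : n → ℝ}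
    (ha : ∀ j, a' j = a j * ((mb j - β₁) * (mb j - β₂) / ((mb j - α₁) * (mb j - α₂))))
    (hb : ∀ k, b' k = b k * ((m k - α₁) * (m k - α₂) / ((m k - β₁) * (m k - β₂))))
    {D : ℝ → ℝ → ℝ} (hD : ∀ α β, D α β = 1 + (α - β) *
      pairing m mb a b (solitonKernel (cauchyLike m mb a b) Ab) α β) :
    (1 + cauchyLike m mb a' b' * Ab).det = (1 + cauchyLike m mb a b * Ab).det *
      (((β₁ - α₂) * (β₂ - α₁) * (D β₁ α₁ * D β₂ α₂) - (β₁ - α₁) * (β₂ - α₂) * (D β₁ α₂ * D β₂ α₁))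
        / ((α₂ - α₁) * (β₁ - β₂))) := by
  set A := cauchyLike m mb a b with hA
  set G := solitonKernel A Ab with hG
  let U : Matrix n (Fin 2) ℝ := of fun j i => a j / (mb j - ![α₁, α₂] i)
  let V : Matrix (Fin 2) n ℝ := of fun l k => b k / (m k - ![β₁, β₂] l)
  let κ : Matrix (Fin 2) (Fin 2) ℝ :=
    !![-((α₁ - β₁) * (α₁ - β₂) / (α₁ - α₂)) * ((β₁ - α₂) / (β₁ - β₂)),
       -((α₁ - β₁) * (α₁ - β₂) / (α₁ - α₂)) * ((β₂ - α₂) / (β₂ - β₁));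
       -((α₂ - β₁) * (α₂ - β₂) / (α₂ - α₁)) * ((β₁ - α₁) / (β₁ - β₂)),
       -((α₂ - β₁) * (α₂ - β₂) / (α₂ - α₁)) * ((β₂ - α₁) / (β₂ - β₁))]
  have hα' := sub_ne_zero.2 hα
  have hβ' := sub_ne_zero.2 hβ
  have hα'' := sub_ne_zero.2 hα.symm
  have hβ'' := sub_ne_zero.2 hβ.symm
  have hUV : cauchyLike m mb a' b' = A + U * (κ * V) := by
    ext j k
    have e1 := sub_ne_zero.2 (hne j k)
    have e2 := sub_ne_zero.2 (hmb j).1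
    have e3 := sub_ne_zero.2 (hmb j).2.1
    have e4 := sub_ne_zero.2 (hm k).1
    have e5 := sub_ne_zero.2 (hm k).2
    simp only [hA, cauchyLike, Matrix.add_apply, mul_apply, of_apply, Fin.sum_univ_two, U, V, κ, ha,
      hb, cons_val_zero, cons_val_one, cons_val', cons_val_fin_one]
    rw [← neg_sub α₁ α₂, ← neg_sub β₁ β₂]
    field_simp
    ring
  have hN : ∀ l i, (V * G * U) l i = pairing m mb a b G (![β₁, β₂] l) (![α₁, α₂] i) := by
    intro l i
    simp only [mul_apply, pairing, Finset.sum_mul, U, V, of_apply]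
    exact Finset.sum_comm
  have hND : ∀ α β, β ≠ α → pairing m mb a b G β α = (D β α - 1) / (β - α) := by
    intro α β h
    rw [hD, eq_div_iff (sub_ne_zero.2 h)]; ring
  rw [det_one_add_mul_update U (κ * V) hUV hdet, ← hG, Matrix.mul_assoc κ, Matrix.mul_assoc κ,
    det_fin_two]
  congr 1
  have f1 := sub_ne_zero.2 h11
  have f2 := sub_ne_zero.2 h12
  have f3 := sub_ne_zero.2 h21
  have f4 := sub_ne_zero.2 h22
  have hκ : ∀ i j, (κ * (V * G * U)) i j = ∑ l, κ i l * (V * G * U) l j := fun i j => mul_apply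
  simp only [Matrix.add_apply, hκ, hN, Fin.sum_univ_two, κ, of_apply, cons_val_zero,
    cons_val_one, cons_val', cons_val_fin_one, hND _ _ h11, hND _ _ h12, hND _ _ h21, hND _ _ h22,
    one_apply_eq, ne_eq, one_ne_zero, zero_ne_one, not_false_eq_true, one_apply_ne]
  rw [← neg_sub α₁ α₂, ← neg_sub β₁ β₂, ← neg_sub β₁ α₁, ← neg_sub β₁ α₂, ← neg_sub β₂ α₁,
    ← neg_sub β₂ α₂]
  field_simp
  ring

theorem solitonKernel_displacement {n : Type*} [Fintype n] [DecidableEq n]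
    {m mb a b cb : n → ℝ} (hne : ∀ j k, mb j ≠ m k)
    {Ab : Matrix n n ℝ} (hAb : ∀ j k, (m j - mb k) * Ab j k = cb k)
    (hdet : (1 + cauchyLike m mb a b * Ab).det ≠ 0) :
    ∃ w v : n → ℝ, ∀ k j, (m k - mb j) * solitonKernel (cauchyLike m mb a b) Ab k j =
      w k * v j - (solitonKernel (cauchyLike m mb a b) Ab *ᵥ a) k *
        (b ᵥ* solitonKernel (cauchyLike m mb a b) Ab) j := by
  set A := cauchyLike m mb a b with hA
  set G := solitonKernel A Ab with hG
  have hu := hdet.isUnit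
  have hGK : G * (1 + A * Ab) = Ab := by
    rw [hG, solitonKernel, Matrix.mul_assoc, nonsing_inv_mul _ hu, Matrix.mul_one]
  have hM1 : diagonal mb * A - A * diagonal m = vecMulVec a b := by
    ext j k
    have := sub_ne_zero.2 (hne j k)
    simp [hA, cauchyLike, vecMulVec_apply]
    field_simp
  have hM2 : diagonal m * Ab - Ab * diagonal mb = vecMulVec 1 cb := by
    ext j k
    simp [vecMulVec_apply, ← hAb j k]
    ring
  have key : (diagonal m * G - G * diagonal mb) * (1 + A * Ab) =
      (1 - G * A) * vecMulVec 1 cb - G * vecMulVec a b * Ab := by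
    have h0 : G + G * A * Ab = Ab := by simpa [Matrix.mul_add, Matrix.mul_assoc] using hGK
    have h1 : (diagonal m * G) * (1 + A * Ab) = diagonal m * Ab := by
      rw [Matrix.mul_assoc, hGK]
    have h2 : (G + G * A * Ab) * diagonal mb = Ab * diagonal mb := by
      rw [h0]
    rw [← hM1, ← hM2, Matrix.sub_mul, h1]
    rw [eq_comm, ← sub_eq_zero] at h2
    rw [← sub_eq_zero, ← h2]
    noncomm_ring
  refine ⟨(1 - G * A) *ᵥ 1, cb ᵥ* (1 + A * Ab)⁻¹, fun k j => ?_⟩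
  have hX : diagonal m * G - G * diagonal mb =
      (diagonal m * G - G * diagonal mb) * (1 + A * Ab) * (1 + A * Ab)⁻¹ := by
    rw [Matrix.mul_assoc, mul_nonsing_inv _ hu, Matrix.mul_one]
  have key2 : diagonal m * G - G * diagonal mb =
      vecMulVec ((1 - G * A) *ᵥ 1) (cb ᵥ* (1 + A * Ab)⁻¹) - vecMulVec (G *ᵥ a) (b ᵥ* G) := by
    rw [← Matrix.mul_vecMulVec, ← Matrix.vecMulVec_mul, ← Matrix.mul_vecMulVec,
      ← Matrix.vecMulVec_mul, hX, key, Matrix.sub_mul]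
    congr 1
    · rw [Matrix.mul_assoc]
    · rw [Matrix.mul_assoc, Matrix.mul_assoc, hG, solitonKernel]
  have := congrFun (congrFun key2 k) j
  simp [vecMulVec_apply] at this
  linear_combination this


theorem one_add_mul_pairing_eq {n : Type*} [Fintype n]
    {m mb a b : n → ℝ} {G : Matrix n n ℝ} {w v : n → ℝ}
    (hG : ∀ k j, (m k - mb j) * G k j = w k * v j - (G *ᵥ a) k * (b ᵥ* G) j) {α β : ℝ}
    (hα : ∀ k, m k ≠ α) (hβ : ∀ k, mb k ≠ β) :
    1 + (α - β) * pairing m mb a b G α β =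
      (1 + ∑ k, b k / (m k - α) * (G *ᵥ a) k) * (1 - ∑ j, (b ᵥ* G) j * (a j / (mb j - β))) +
        (∑ k, b k / (m k - α) * w k) * ∑ j, v j * (a j / (mb j - β)) := by
  have e1 : ∑ k, b k / (m k - α) * (G *ᵥ a) k = ∑ k, ∑ j, b k / (m k - α) * G k j * a j := by
    simp only [mulVec, dotProduct, Finset.mul_sum, mul_assoc]
  have e2 : ∑ j, (b ᵥ* G) j * (a j / (mb j - β)) = ∑ k, ∑ j, b k * G k j * (a j / (mb j - β)) := by
    simp only [vecMul, dotProduct, Finset.sum_mul]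
    exact Finset.sum_comm
  have e3 : (α - β) * pairing m mb a b G α β =
      ∑ k, ∑ j, (b k / (m k - α) * w k) * (v j * (a j / (mb j - β)))
      - ∑ k, ∑ j, (b k / (m k - α) * (G *ᵥ a) k) * ((b ᵥ* G) j * (a j / (mb j - β)))
      + ∑ k, ∑ j, b k / (m k - α) * G k j * a j - ∑ k, ∑ j, b k * G k j * (a j / (mb j - β)) := by
    simp only [pairing, Finset.mul_sum, ← Finset.sum_add_distrib, ← Finset.sum_sub_distrib]
    refine Finset.sum_congr rfl fun k _ => Finset.sum_congr rfl fun j _ => ?_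
    have h1 := sub_ne_zero.2 (hα k)
    have h2 := sub_ne_zero.2 (hβ j)
    have h3 := hG k j
    field_simp
    linear_combination (b k * a j) * h3
  rw [e3, ← Finset.sum_mul_sum, ← Finset.sum_mul_sum, ← e1, ← e2]
  ring

/-- The difference `l_ζ(s)` of `h_ζ(s)` and its inverse, in partial fractions. -/
def flowRate (ζ s : ℝ) : ℝ := -2 * ζ * (1 / (s - ζ) + 1 / (s + ζ))

/-- The logarithmic derivative of the soliton determinant along the flow with rate `flowRate ζ`. -/
def logTauDeriv {n : Type*} [Fintype n] (m mb a b : n → ℝ) (G : Matrix n n ℝ) (ζ : ℝ) : ℝ :=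
  -2 * ζ * (pairing m mb a b G ζ ζ + pairing m mb a b G (-ζ) (-ζ))

theorem hasDerivAt_cauchyLike {n : Type*} {m mb : n → ℝ} {a b : ℝ → n → ℝ} {ζ t : ℝ}
    (hne : ∀ j k, mb j ≠ m k) (hm : ∀ k, m k ≠ ζ ∧ m k ≠ -ζ) (hmb : ∀ k, mb k ≠ ζ ∧ mb k ≠ -ζ)
    (ha : ∀ j, HasDerivAt (fun s => a s j) (-flowRate ζ (mb j) * a t j) t)
    (hb : ∀ k, HasDerivAt (fun s => b s k) (flowRate ζ (m k) * b t k) t) (j k : n) :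
    HasDerivAt (fun s => cauchyLike m mb (a s) (b s) j k)
      (-2 * ζ * (a t j / (mb j - ζ) * (b t k / (m k - ζ)) +
        a t j / (mb j - -ζ) * (b t k / (m k - -ζ)))) t := by
  have h1 := sub_ne_zero.2 (hm k).1
  have h2 := sub_ne_zero.2 (hm k).2
  have h3 := sub_ne_zero.2 (hmb j).1
  have h4 := sub_ne_zero.2 (hmb j).2
  have h5 := sub_ne_zero.2 (hne j k)
  rw [sub_neg_eq_add] at h2 h4
  refine (((ha j).fun_mul (hb k)).div_const (mb j - m k)).congr_deriv ?_
  simp only [flowRate, sub_neg_eq_add]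
  field_simp
  ring

theorem hasDerivAt_one_add_mul {n : Type*} [Fintype n] [DecidableEq n]
    {A : ℝ → Matrix n n ℝ} {A' : Matrix n n ℝ} {t : ℝ}
    (hA : ∀ j k, HasDerivAt (fun s => A s j k) (A' j k) t) (Ab : Matrix n n ℝ) (i j : n) :
    HasDerivAt (fun s => (1 + A s * Ab) i j) ((A' * Ab) i j) t := by
  simp only [Matrix.add_apply, mul_apply]
  exact (HasDerivAt.fun_sum fun k _ => (hA i k).mul_const (Ab k j)).const_add _

theorem hasDerivAt_log_det {n : Type*} [Fintype n] [DecidableEq n]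
    {m mb : n → ℝ} {a b : ℝ → n → ℝ} {Ab : Matrix n n ℝ} {ζ t : ℝ}
    (hne : ∀ j k, mb j ≠ m k) (hm : ∀ k, m k ≠ ζ ∧ m k ≠ -ζ) (hmb : ∀ k, mb k ≠ ζ ∧ mb k ≠ -ζ)
    (ha : ∀ j, HasDerivAt (fun s => a s j) (-flowRate ζ (mb j) * a t j) t)
    (hb : ∀ k, HasDerivAt (fun s => b s k) (flowRate ζ (m k) * b t k) t)
    (hdet : (1 + cauchyLike m mb (a t) (b t) * Ab).det ≠ 0) :
    HasDerivAt (fun s => Real.log (1 + cauchyLike m mb (a s) (b s) * Ab).det)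
      (logTauDeriv m mb (a t) (b t) (solitonKernel (cauchyLike m mb (a t) (b t)) Ab) ζ) t := by
  let A' : Matrix n n ℝ := of fun j k => -2 * ζ * (a t j / (mb j - ζ) * (b t k / (m k - ζ)) +
        a t j / (mb j - -ζ) * (b t k / (m k - -ζ)))
  have hA : ∀ j k, HasDerivAt (fun s => cauchyLike m mb (a s) (b s) j k) (A' j k) t :=
    hasDerivAt_cauchyLike hne hm hmb ha hb
  refine ((hasDerivAt_det (hasDerivAt_one_add_mul hA Ab)).log hdet).congr_deriv ?_
  set K := 1 + cauchyLike m mb (a t) (b t) * Ab with hK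
  have h1 : (K.adjugate * (A' * Ab)).trace / K.det = (solitonKernel (cauchyLike m mb (a t) (b t)) Ab
      * A').trace := by
    rw [solitonKernel, ← hK, Matrix.mul_assoc, trace_mul_comm Ab, Matrix.mul_assoc, inv_def,
      Ring.inverse_eq_inv', Matrix.smul_mul, trace_smul, smul_eq_mul]
    ring
  rw [h1]
  simp only [trace, diag_apply, mul_apply, logTauDeriv, pairing, Finset.mul_sum,
    ← Finset.sum_add_distrib, A', of_apply]
  refine Finset.sum_congr rfl fun k _ => Finset.sum_congr rfl fun j _ => ?_
  ring

theorem hasDerivAt_pairing {n : Type*} [Fintype n] [DecidableEq n]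
    {m mb : n → ℝ} {a b : ℝ → n → ℝ} {Ab : Matrix n n ℝ} {ζ t β : ℝ}
    (hne : ∀ j k, mb j ≠ m k) (hm : ∀ k, m k ≠ ζ ∧ m k ≠ -ζ) (hmb : ∀ k, mb k ≠ ζ ∧ mb k ≠ -ζ)
    (ha : ∀ j, HasDerivAt (fun s => a s j) (-flowRate ζ (mb j) * a t j) t)
    (hb : ∀ k, HasDerivAt (fun s => b s k) (flowRate ζ (m k) * b t k) t)
    (hdet : ∀ s, (1 + cauchyLike m mb (a s) (b s) * Ab).det ≠ 0)
    (hmβ : ∀ k, m k ≠ β) (hmbβ : ∀ k, mb k ≠ β) (h1 : ζ ≠ β) (h2 : -ζ ≠ β) {N : ℝ → ℝ → ℝ}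
    (hN : N = pairing m mb (a t) (b t) (solitonKernel (cauchyLike m mb (a t) (b t)) Ab)) :
    HasDerivAt
      (fun s => pairing m mb (a s) (b s) (solitonKernel (cauchyLike m mb (a s) (b s)) Ab) β β)
      (-2 * ζ * (((N ζ β - N β ζ) / (ζ - β) - N β ζ * N ζ β) +
        ((N (-ζ) β - N β (-ζ)) / (-ζ - β) - N β (-ζ) * N (-ζ) β))) t := by
  let A' : Matrix n n ℝ := of fun j k => -2 * ζ * (a t j / (mb j - ζ) * (b t k / (m k - ζ)) +
        a t j / (mb j - -ζ) * (b t k / (m k - -ζ)))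
  have hA : ∀ j k, HasDerivAt (fun s => cauchyLike m mb (a s) (b s) j k) (A' j k) t :=
    hasDerivAt_cauchyLike hne hm hmb ha hb
  set G := fun s => solitonKernel (cauchyLike m mb (a s) (b s)) Ab with hGdef
  change N = pairing m mb (a t) (b t) (G t) at hN
  have hG : ∀ k j, HasDerivAt (fun s => G s k j) (-(G t * A' * G t) k j) t := by
    intro k j
    have h := HasDerivAt.fun_sum (u := Finset.univ) fun i _ =>
      (hasDerivAt_matrix_inv (hasDerivAt_one_add_mul hA Ab) hdet i j).const_mul (Ab k i)
    simp only [hGdef, solitonKernel]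
    simp only [mul_apply (M := Ab)]
    refine h.congr_deriv ?_
    simp only [mul_neg, Finset.sum_neg_distrib, ← mul_apply, Matrix.mul_assoc]
  have hA2 : ∀ k j, (G t * A' * G t) k j = -2 * ζ *
      ((∑ i, G t k i * (a t i / (mb i - ζ))) * (∑ i, b t i / (m i - ζ) * G t i j) +
       (∑ i, G t k i * (a t i / (mb i - -ζ))) * (∑ i, b t i / (m i - -ζ) * G t i j)) := by
    intro k j
    simp only [mul_apply, Finset.sum_mul, Finset.mul_sum, A', of_apply,
      ← Finset.sum_add_distrib]
    refine Finset.sum_congr rfl fun k _ => Finset.sum_congr rfl fun j _ => ?_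
    ring
  have hprod : ∀ γ, N β γ * N γ β = ∑ k, ∑ j, b t k / (m k - β) *
      ((∑ i, G t k i * (a t i / (mb i - γ))) * (∑ i, b t i / (m i - γ) * G t i j)) *
        (a t j / (mb j - β)) := by
    intro γ
    have e1 : N β γ = ∑ k, b t k / (m k - β) * ∑ i, G t k i * (a t i / (mb i - γ)) := by
      simp only [hN, pairing, Finset.mul_sum, mul_assoc]
    have e2 : N γ β = ∑ j, (∑ i, b t i / (m i - γ) * G t i j) * (a t j / (mb j - β)) := by
      simp only [hN, pairing, Finset.sum_mul]
      exact Finset.sum_comm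
    rw [e1, e2, Finset.sum_mul_sum]
    refine Finset.sum_congr rfl fun k _ => Finset.sum_congr rfl fun j _ => ?_
    ring
  have hdiff : ∀ γ, γ ≠ β → (∀ k, m k ≠ γ) → (∀ k, mb k ≠ γ) → (N γ β - N β γ) / (γ - β) =
      ∑ k, ∑ j, b t k / (m k - β) * G t k j * (a t j / (mb j - β)) *
        (1 / (m k - γ) - 1 / (mb j - γ)) := by
    intro γ h hγ hγ'
    rw [div_eq_iff (sub_ne_zero.2 h)]
    simp only [hN, pairing, ← Finset.sum_sub_distrib, Finset.sum_mul]
    refine Finset.sum_congr rfl fun k _ => Finset.sum_congr rfl fun j _ => ?_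
    have := sub_ne_zero.2 (hγ k)
    have := sub_ne_zero.2 (hγ' j)
    have := sub_ne_zero.2 (hmβ k)
    have := sub_ne_zero.2 (hmbβ j)
    field_simp
    ring
  have hmain := HasDerivAt.fun_sum (u := Finset.univ) fun k _ =>
    HasDerivAt.fun_sum (u := Finset.univ) fun j _ =>
      (((hb k).div_const (m k - β)).fun_mul (hG k j)).fun_mul ((ha j).div_const (mb j - β))
  refine hmain.congr_deriv ?_
  rw [hdiff ζ h1 (fun k => (hm k).1) (fun k => (hmb k).1),
    hdiff (-ζ) h2 (fun k => (hm k).2) (fun k => (hmb k).2), hprod, hprod]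
  simp only [← Finset.sum_add_distrib, ← Finset.sum_sub_distrib, Finset.mul_sum (s := Finset.univ)
    (a := -2 * ζ), hA2, flowRate, sub_neg_eq_add]
  refine Finset.sum_congr rfl fun k _ => Finset.sum_congr rfl fun j _ => ?_
  ring

theorem pairing_quotient_eq {N : ℝ → ℝ → ℝ} {D : ℝ → ℝ → ℝ}
    (hD : ∀ α β, D α β = 1 + (α - β) * N α β) {α β : ℝ} (h : α ≠ β) :
    (N α β - N β α) / (α - β) - N β α * N α β = (D α β * D β α - 1) / (α - β) ^ 2 := by
  have h' := sub_ne_zero.2 h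
  rw [hD, hD]
  field_simp
  ring

/-- The exponential factor of the matrices `A` and `Ā`. -/
def planeWave (lam mu x y : ℝ) (n₁ n₂ : ℤ) (s : ℝ) : ℝ :=
  Real.exp (x * soll lam s + y * soll mu s) * solh lam s ^ (n₁ + n₂) * solh mu s ^ (n₂ - n₁)

theorem solh_ne_zero {ζ s : ℝ} (h1 : s ≠ ζ) (h2 : s ≠ -ζ) : solh ζ s ≠ 0 :=
  div_ne_zero (sub_ne_zero.2 h1) (by rwa [← sub_neg_eq_add, sub_ne_zero])

theorem soll_eq_flowRate {ζ s : ℝ} (h1 : s ≠ ζ) (h2 : s ≠ -ζ) : soll ζ s = flowRate ζ s := by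
  have e1 : s - ζ ≠ 0 := sub_ne_zero.2 h1
  have e2 : s + ζ ≠ 0 := by rwa [← sub_neg_eq_add, sub_ne_zero]
  simp only [soll, solh, flowRate]
  field_simp
  ring

theorem planeWave_ne_zero {lam mu s : ℝ} (hs : s ≠ lam ∧ s ≠ -lam ∧ s ≠ mu ∧ s ≠ -mu)
    (x y : ℝ) (n₁ n₂ : ℤ) : planeWave lam mu x y n₁ n₂ s ≠ 0 :=
  mul_ne_zero (mul_ne_zero (Real.exp_ne_zero _) (zpow_ne_zero _ (solh_ne_zero hs.1 hs.2.1)))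
    (zpow_ne_zero _ (solh_ne_zero hs.2.2.1 hs.2.2.2))

theorem planeWave_shift {lam mu s : ℝ} (hs : s ≠ lam ∧ s ≠ -lam ∧ s ≠ mu ∧ s ≠ -mu)
    (x y : ℝ) (n₁ n₂ d₁ d₂ : ℤ) : planeWave lam mu x y (n₁ + d₁) (n₂ + d₂) s =
      planeWave lam mu x y n₁ n₂ s * (solh lam s ^ (d₁ + d₂) * solh mu s ^ (d₂ - d₁)) := by
  rw [planeWave, planeWave, add_add_add_comm, add_sub_add_comm,
    zpow_add₀ (solh_ne_zero hs.1 hs.2.1), zpow_add₀ (solh_ne_zero hs.2.2.1 hs.2.2.2)]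
  ring

theorem hasDerivAt_planeWave_fst {lam mu s : ℝ} (h1 : s ≠ lam) (h2 : s ≠ -lam)
    (x y : ℝ) (n₁ n₂ : ℤ) : HasDerivAt (fun x' => planeWave lam mu x' y n₁ n₂ s)
      (flowRate lam s * planeWave lam mu x y n₁ n₂ s) x := by
  refine ((((((hasDerivAt_id x).mul_const (soll lam s)).add_const (y * soll mu s)).exp.mul_const
    (solh lam s ^ (n₁ + n₂))).mul_const (solh mu s ^ (n₂ - n₁)))).congr_deriv ?_
  rw [← soll_eq_flowRate h1 h2, planeWave]
  simp only [id]
  ring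

theorem hasDerivAt_planeWave_snd {lam mu s : ℝ} (h1 : s ≠ mu) (h2 : s ≠ -mu)
    (x y : ℝ) (n₁ n₂ : ℤ) : HasDerivAt (fun y' => planeWave lam mu x y' n₁ n₂ s)
      (flowRate mu s * planeWave lam mu x y n₁ n₂ s) y := by
  refine ((((((hasDerivAt_id y).mul_const (soll mu s)).const_add (x * soll lam s)).exp.mul_const
    (solh lam s ^ (n₁ + n₂))).mul_const (solh mu s ^ (n₂ - n₁)))).congr_deriv ?_
  rw [← soll_eq_flowRate h1 h2, planeWave]
  simp only [id]
  ring

theorem HasDerivAt.inv_of_rate {f : ℝ → ℝ} {r t : ℝ} (h : HasDerivAt f (r * f t) t)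
    (hf : f t ≠ 0) : HasDerivAt (fun s => (f s)⁻¹) (-r * (f t)⁻¹) t := by
  refine (h.inv hf).congr_deriv ?_
  field_simp

theorem det_one_add_solA_mul_solAb {N : ℕ} {lam mu : ℝ} {m mb c cb : Fin N → ℝ}
    (x y : ℝ) (n₁ n₂ : ℤ) :
    ((1 : Matrix (Fin N) (Fin N) ℝ) +
      solA N lam mu m mb c x y n₁ n₂ * solAb N lam mu m mb cb x y n₁ n₂).det =
    (1 + cauchyLike m mb (fun j => (planeWave lam mu x y n₁ n₂ (mb j))⁻¹)
      (fun k => c k * planeWave lam mu x y n₁ n₂ (m k)) *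
        of fun j k => cb k / (m j - mb k)).det := by
  have h1 : solAb N lam mu m mb cb x y n₁ n₂ = (of fun j k => cb k / (m j - mb k)) *
      diagonal fun j => (planeWave lam mu x y n₁ n₂ (mb j))⁻¹ := by
    ext j k
    have e : ∀ ζ s, solhb ζ s = (solh ζ s)⁻¹ := fun ζ s => (inv_div _ _).symm
    have e' : ∀ ζ s, sollb ζ s = -soll ζ s := by
      intro ζ s
      simp only [sollb, soll, e, one_div, inv_inv, neg_sub]
    simp only [solAb, mul_diagonal, of_apply, planeWave, e, e', mul_neg, ← neg_add, Real.exp_neg,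
      _root_.inv_zpow, mul_inv, mul_assoc]
  have h2 : diagonal (fun j => (planeWave lam mu x y n₁ n₂ (mb j))⁻¹) *
      solA N lam mu m mb c x y n₁ n₂ =
        cauchyLike m mb (fun j => (planeWave lam mu x y n₁ n₂ (mb j))⁻¹)
          (fun k => c k * planeWave lam mu x y n₁ n₂ (m k)) := by
    ext j k
    simp only [solA, diagonal_mul, of_apply, cauchyLike, planeWave]
    ring
  rw [h1, ← Matrix.mul_assoc, det_one_add_mul_comm, ← Matrix.mul_assoc, h2]

theorem exp_second_difference {r t₀ t₁ t₂ : ℝ} (hr : r ≠ 0) (h₀ : 0 < t₀) (h₁ : 0 < t₁)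
    (h₂ : 0 < t₂) : Real.exp (2 * Real.log |r| +
      (Real.log t₁ - 2 * Real.log t₀ + Real.log t₂)) = r ^ 2 * ((t₁ / t₀) * (t₂ / t₀)) := by
  have e : 2 * Real.log |r| + (Real.log t₁ - 2 * Real.log t₀ + Real.log t₂) =
      Real.log |r| + Real.log |r| + ((Real.log t₁ - Real.log t₀) + (Real.log t₂ - Real.log t₀)) := by
    ring
  simp only [e, Real.exp_add, Real.exp_sub, Real.exp_log (abs_pos.2 hr), Real.exp_log h₀,
    Real.exp_log h₁, Real.exp_log h₂, abs_mul_abs_self]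
  ring

theorem toda22_soliton_solution
    (N : ℕ) (hN : 1 ≤ N) (lam mu : ℝ)
    (hlm : lam * mu * (lam - mu) * (lam + mu) ≠ 0)
    (m mb c cb : Fin N → ℝ)
    (hmmb : ∀ j k, mb j ≠ m k) (hmbm : ∀ j k, m j ≠ mb k)
    (hm : ∀ k, m k ≠ lam ∧ m k ≠ -lam ∧ m k ≠ mu ∧ m k ≠ -mu)
    (hmb : ∀ k, mb k ≠ lam ∧ mb k ≠ -lam ∧ mb k ≠ mu ∧ mb k ≠ -mu)
    (hpos : ∀ (x y : ℝ) (n₁ n₂ : ℤ),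
      0 < ((1 : Matrix (Fin N) (Fin N) ℝ) +
        solA N lam mu m mb c x y n₁ n₂ * solAb N lam mu m mb cb x y n₁ n₂).det)
    (u : ℝ → ℝ → ℤ → ℤ → ℝ)
    (hu : ∀ (x y : ℝ) (n₁ n₂ : ℤ),
      u x y n₁ n₂ = solPhi lam mu x y n₁ n₂ +
        Real.log (((1 : Matrix (Fin N) (Fin N) ℝ) +
          solA N lam mu m mb c x y n₁ n₂ * solAb N lam mu m mb cb x y n₁ n₂).det)) :
    ∀ (x y : ℝ) (n₁ n₂ : ℤ),
      deriv (fun x' => deriv (fun y' => u x' y' n₁ n₂) y) x =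
        Real.exp (u x y (n₁ + 1) n₂ - 2 * u x y n₁ n₂ + u x y (n₁ - 1) n₂) -
        Real.exp (u x y n₁ (n₂ + 1) - 2 * u x y n₁ n₂ + u x y n₁ (n₂ - 1)) := by
  intro x y n₁ n₂
  have hlam : lam ≠ 0 := by rintro rfl; simp at hlm
  have hmu : mu ≠ 0 := by rintro rfl; simp at hlm
  have hsub : lam - mu ≠ 0 := by rintro h; simp [h] at hlm
  have hadd : lam + mu ≠ 0 := by rintro h; simp [h] at hlm
  have hne1 : lam ≠ -lam := fun h => hlam (by linarith)
  have hne2 : mu ≠ -mu := fun h => hmu (by linarith)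
  have hne3 : lam ≠ mu := sub_ne_zero.1 hsub
  have hne4 : lam ≠ -mu := fun h => hadd (by linarith)
  have hne5 : -lam ≠ mu := fun h => hadd (by linarith)
  have hne6 : -lam ≠ -mu := fun h => hsub (by linarith)
  let Ab : Matrix (Fin N) (Fin N) ℝ := of fun j k => cb k / (m j - mb k)
  let a : ℝ → ℝ → ℤ → ℤ → Fin N → ℝ := fun x y n₁ n₂ j => (planeWave lam mu x y n₁ n₂ (mb j))⁻¹
  let b : ℝ → ℝ → ℤ → ℤ → Fin N → ℝ := fun x y n₁ n₂ k => c k * planeWave lam mu x y n₁ n₂ (m k)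
  let τ : ℝ → ℝ → ℤ → ℤ → ℝ := fun x y n₁ n₂ =>
    (1 + cauchyLike m mb (a x y n₁ n₂) (b x y n₁ n₂) * Ab).det
  let P : ℝ → ℝ → ℝ → ℝ := fun x' => pairing m mb (a x' y n₁ n₂) (b x' y n₁ n₂)
    (solitonKernel (cauchyLike m mb (a x' y n₁ n₂) (b x' y n₁ n₂)) Ab)
  let D : ℝ → ℝ → ℝ := fun α β => 1 + (α - β) * P x α β
  have hD : ∀ α β, D α β = 1 + (α - β) * P x α β := fun _ _ => rfl
  have hτ : ∀ x y n₁ n₂, 0 < τ x y n₁ n₂ := fun x y n₁ n₂ => by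
    simpa only [det_one_add_solA_mul_solAb] using hpos x y n₁ n₂
  have hu' : ∀ x y n₁ n₂, u x y n₁ n₂ = solPhi lam mu x y n₁ n₂ + Real.log (τ x y n₁ n₂) :=
    fun x y n₁ n₂ => by rw [hu, det_one_add_solA_mul_solAb]
  have hay : ∀ x j, HasDerivAt (fun y' => a x y' n₁ n₂ j)
      (-flowRate mu (mb j) * a x y n₁ n₂ j) y := fun x j =>
    (hasDerivAt_planeWave_snd (hmb j).2.2.1 (hmb j).2.2.2 x y n₁ n₂).inv_of_rate
      (planeWave_ne_zero (hmb j) _ _ _ _)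
  have hby : ∀ x k, HasDerivAt (fun y' => b x y' n₁ n₂ k)
      (flowRate mu (m k) * b x y n₁ n₂ k) y := fun x k =>
    ((hasDerivAt_planeWave_snd (hm k).2.2.1 (hm k).2.2.2 x y n₁ n₂).const_mul (c k)).congr_deriv
      (mul_left_comm _ _ _)
  have hax : ∀ j, HasDerivAt (fun x' => a x' y n₁ n₂ j)
      (-flowRate lam (mb j) * a x y n₁ n₂ j) x := fun j =>
    (hasDerivAt_planeWave_fst (hmb j).1 (hmb j).2.1 x y n₁ n₂).inv_of_rate
      (planeWave_ne_zero (hmb j) _ _ _ _)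
  have hbx : ∀ k, HasDerivAt (fun x' => b x' y n₁ n₂ k)
      (flowRate lam (m k) * b x y n₁ n₂ k) x := fun k =>
    ((hasDerivAt_planeWave_fst (hm k).1 (hm k).2.1 x y n₁ n₂).const_mul (c k)).congr_deriv
      (mul_left_comm _ _ _)
  have hderiv_y : ∀ x', deriv (fun y' => u x' y' n₁ n₂) y =
      8 * x' * (lam * mu * (lam ^ 2 + mu ^ 2) / (lam ^ 2 - mu ^ 2) ^ 2) +
        -2 * mu * (P x' mu mu + P x' (-mu) (-mu)) := by
    intro x'
    simp only [hu', solPhi]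
    have h1 := hasDerivAt_log_det hmmb (fun k => (hm k).2.2) (fun k => (hmb k).2.2) (hay x')
      (hby x') (hτ x' y n₁ n₂).ne'
    refine ((((((hasDerivAt_id y).const_mul (8 * x')).mul_const _).add_const _).fun_add
      h1).congr_deriv ?_).deriv
    rw [mul_one]
    rfl
  have hderiv_P : ∀ β, (∀ k, m k ≠ β) → (∀ k, mb k ≠ β) → lam ≠ β → -lam ≠ β →
      HasDerivAt (fun x' => P x' β β) (-2 * lam * ((D lam β * D β lam - 1) / (lam - β) ^ 2 +
        (D (-lam) β * D β (-lam) - 1) / (-lam - β) ^ 2)) x := by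
    intro β h1 h2 h3 h4
    rw [← pairing_quotient_eq hD h3, ← pairing_quotient_eq hD h4]
    exact hasDerivAt_pairing hmmb (fun k => ⟨(hm k).1, (hm k).2.1⟩)
      (fun k => ⟨(hmb k).1, (hmb k).2.1⟩) hax hbx (fun s => (hτ s y n₁ n₂).ne') h1 h2 h3 h4 rfl
  have hshift : ∀ {d₁ d₂ : ℤ} {α₁ α₂ β₁ β₂ : ℝ}, α₁ ≠ α₂ → β₁ ≠ β₂ → β₁ ≠ α₁ → β₁ ≠ α₂ →
      β₂ ≠ α₁ → β₂ ≠ α₂ →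
      (∀ s, (s ≠ lam ∧ s ≠ -lam ∧ s ≠ mu ∧ s ≠ -mu) →
        (s ≠ α₁ ∧ s ≠ α₂ ∧ s ≠ β₁ ∧ s ≠ β₂) ∧ solh lam s ^ (d₁ + d₂) * solh mu s ^ (d₂ - d₁) =
          (s - α₁) * (s - α₂) / ((s - β₁) * (s - β₂))) →
      τ x y (n₁ + d₁) (n₂ + d₂) / τ x y n₁ n₂ = ((β₁ - α₂) * (β₂ - α₁) * (D β₁ α₁ * D β₂ α₂) -
        (β₁ - α₁) * (β₂ - α₂) * (D β₁ α₂ * D β₂ α₁)) / ((α₂ - α₁) * (β₁ - β₂)) := by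
    intro d₁ d₂ α₁ α₂ β₁ β₂ h1 h2 h3 h4 h5 h6 h
    rw [div_eq_iff (hτ _ _ _ _).ne', mul_comm]
    refine det_shift (hτ x y n₁ n₂).ne' hmmb h1 h2 h3 h4 h5 h6 (fun k => (h _ (hm k)).1.2.2)
      (fun k => (h _ (hmb k)).1) (fun j => ?_) (fun k => ?_) hD
    · simp only [a]
      rw [planeWave_shift (hmb j), (h _ (hmb j)).2, mul_inv, inv_div]
    · simp only [b]
      rw [planeWave_shift (hm k), (h _ (hm k)).2, mul_assoc]
  have hτ₁ : τ x y (n₁ + 1) n₂ / τ x y n₁ n₂ = ((lam - mu) ^ 2 * (D (-lam) lam * D mu (-mu)) +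
      4 * lam * mu * (D (-lam) (-mu) * D mu lam)) / (lam + mu) ^ 2 := by
    have h := hshift (d₁ := 1) (d₂ := 0) hne4 hne5 hne1.symm hne6 hne3.symm hne2 fun s hs =>
      ⟨⟨hs.1, hs.2.2.2, hs.2.1, hs.2.2.1⟩, by
        norm_num [solh, div_mul_div_comm]⟩
    rw [add_zero] at h
    refine h.trans ?_
    congr 1 <;> ring
  have hτ₂ : τ x y (n₁ - 1) n₂ / τ x y n₁ n₂ = ((lam - mu) ^ 2 * (D lam (-lam) * D (-mu) mu) +
      4 * lam * mu * (D lam mu * D (-mu) (-lam))) / (lam + mu) ^ 2 := by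
    have h := hshift (d₁ := -1) (d₂ := 0) hne5 hne4 hne1 hne3 hne6.symm hne2.symm fun s hs =>
      ⟨⟨hs.2.1, hs.2.2.1, hs.1, hs.2.2.2⟩, by
        norm_num [solh, div_mul_div_comm]⟩
    rw [add_zero] at h
    refine h.trans ?_
    congr 1 <;> ring
  have hτ₃ : τ x y n₁ (n₂ + 1) / τ x y n₁ n₂ = ((lam + mu) ^ 2 * (D (-lam) lam * D (-mu) mu) -
      4 * lam * mu * (D (-lam) mu * D (-mu) lam)) / (lam - mu) ^ 2 := by
    have h := hshift (d₁ := 0) (d₂ := 1) hne3 hne6 hne1.symm hne5 hne4.symm hne2.symm fun s hs =>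
      ⟨⟨hs.1, hs.2.2.1, hs.2.1, hs.2.2.2⟩, by
        norm_num [solh, div_mul_div_comm]⟩
    rw [add_zero] at h
    refine h.trans ?_
    congr 1 <;> ring
  have hτ₄ : τ x y n₁ (n₂ - 1) / τ x y n₁ n₂ = ((lam + mu) ^ 2 * (D lam (-lam) * D mu (-mu)) -
      4 * lam * mu * (D lam (-mu) * D mu (-lam))) / (lam - mu) ^ 2 := by
    have h := hshift (d₁ := 0) (d₂ := -1) hne6 hne3 hne1 hne4 hne5.symm hne2 fun s hs =>
      ⟨⟨hs.2.1, hs.2.2.2, hs.1, hs.2.2.1⟩, by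
        norm_num [solh, div_mul_div_comm]⟩
    rw [add_zero] at h
    refine h.trans ?_
    congr 1 <;> ring
  have hexp₁ : Real.exp (u x y (n₁ + 1) n₂ - 2 * u x y n₁ n₂ + u x y (n₁ - 1) n₂) =
      ((lam + mu) / (lam - mu)) ^ 2 * (τ x y (n₁ + 1) n₂ / τ x y n₁ n₂ *
        (τ x y (n₁ - 1) n₂ / τ x y n₁ n₂)) := by
    rw [← exp_second_difference (div_ne_zero hadd hsub) (hτ _ _ _ _) (hτ _ _ _ _) (hτ _ _ _ _)]
    simp only [hu', solPhi]
    push_cast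
    ring_nf
  have hexp₂ : Real.exp (u x y n₁ (n₂ + 1) - 2 * u x y n₁ n₂ + u x y n₁ (n₂ - 1)) =
      ((lam - mu) / (lam + mu)) ^ 2 * (τ x y n₁ (n₂ + 1) / τ x y n₁ n₂ *
        (τ x y n₁ (n₂ - 1) / τ x y n₁ n₂)) := by
    rw [← exp_second_difference (div_ne_zero hsub hadd) (hτ _ _ _ _) (hτ _ _ _ _) (hτ _ _ _ _)]
    simp only [hu', solPhi]
    rw [← inv_div (lam + mu), abs_inv, Real.log_inv]
    push_cast
    ring_nf
  rw [hexp₁, hexp₂, hτ₁, hτ₂, hτ₃, hτ₄]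
  obtain ⟨w, v, hwv⟩ := solitonKernel_displacement hmmb
    (fun j k => mul_div_cancel₀ (cb k) (sub_ne_zero.2 (hmbm j k))) (hτ x y n₁ n₂).ne'
  have hrank : ∀ i j : {s : ℝ // s = lam ∨ s = -lam ∨ s = mu ∨ s = -mu}, D i j = _ := fun i j =>
    one_add_mul_pairing_eq hwv
      (fun k h => by
        rcases i.2 with e | e | e | e
        exacts [(hm k).1 (h.trans e), (hm k).2.1 (h.trans e), (hm k).2.2.1 (h.trans e),
          (hm k).2.2.2 (h.trans e)])
      (fun k h => by
        rcases j.2 with e | e | e | e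
        exacts [(hmb k).1 (h.trans e), (hmb k).2.1 (h.trans e), (hmb k).2.2.1 (h.trans e),
          (hmb k).2.2.2 (h.trans e)])
  have hid := toda_projector_identity hrank (fun i => by simp [D])
    ⟨lam, by simp⟩ ⟨-lam, by simp⟩ ⟨mu, by simp⟩ ⟨-mu, by simp⟩ hsub hadd
  rw [← hid]
  simp only [hderiv_y]
  have e1 := hderiv_P mu (fun k => (hm k).2.2.1) (fun k => (hmb k).2.2.1) hne3 hne5
  have e2 := hderiv_P (-mu) (fun k => (hm k).2.2.2) (fun k => (hmb k).2.2.2) hne4 hne6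
  refine (((((hasDerivAt_id x).const_mul 8).mul_const _).fun_add
    ((e1.fun_add e2).const_mul (-2 * mu))).congr_deriv ?_).deriv
  ring

end
end

section
/- Let α, β, γ be pairwise distinct nonzero reals with α+β, α+γ, β+γ all nonzero, such that m_k ∉ {α,−α,β,−β,γ,−γ} and m̄_k ∉ {α,−α,β,−β,γ,−γ} for all k, and assume 1 + A·Ā is invertible. Then the tau-functions satisfy the Miwa (discrete BKP) equation: τ[∅]·τ[{α,β,γ}] = Γ_{α,{β,γ}}·τ[{α}]·τ[{β,γ}] + Γ_{β,{α,γ}}·τ[{β}]·τ[{α,γ}] + Γ_{γ,{α,β}}·τ[{γ}]·τ[{α,β}]. -/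
open Matrix

noncomputable section

/-- `H_ζ = (M - ζ)(M + ζ)⁻¹` for `M = diag(m)`. -/
def Hmat {N : ℕ} (m : Fin N → ℝ) (ζ : ℝ) : Matrix (Fin N) (Fin N) ℝ :=
  (Matrix.diagonal m - ζ • 1) * (Matrix.diagonal m + ζ • 1)⁻¹

/-- `H̄_ζ = (M̄ + ζ)(M̄ - ζ)⁻¹` for `M̄ = diag(m̄)`. -/
def Hbmat {N : ℕ} (mb : Fin N → ℝ) (ζ : ℝ) : Matrix (Fin N) (Fin N) ℝ :=
  (Matrix.diagonal mb + ζ • 1) * (Matrix.diagonal mb - ζ • 1)⁻¹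

/-- `τ[S] = det(1 + A·(∏_{ζ∈S} H_ζ)·Ā·(∏_{ζ∈S} H̄_ζ))`, the set `S` given as a list. -/
def tauL {N : ℕ} (m mb : Fin N → ℝ) (A Ab : Matrix (Fin N) (Fin N) ℝ)
    (S : List ℝ) : ℝ :=
  ((1 : Matrix (Fin N) (Fin N) ℝ) +
    A * (S.map (Hmat m)).prod * Ab * (S.map (Hbmat mb)).prod).det

section RankOneSylvester

variable {n : Type*} [Fintype n] [DecidableEq n] {m mb αv αb av ab : n → ℝ}
  {A Ab G : Matrix n n ℝ}

/-- The resolvent-dressed matrix `Ā(1 + AĀ)⁻¹` satisfies a Sylvester equation of rank two. -/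
lemma sylvester_resolvent {M Mb E F : Matrix n n ℝ}
    (hA : Mb * A - A * M = E) (hAb : M * Ab - Ab * Mb = F)
    (hG : (1 + A * Ab) * G = 1) (hG' : G * (1 + A * Ab) = 1) :
    M * (Ab * G) - Ab * G * Mb = (1 - Ab * G * A) * F * G - Ab * G * E * (Ab * G) := by
  subst hA hAb
  have h1 : G * A * Ab = 1 - G := by
    rw [← hG']; noncomm_ring
  have h2 : A * Ab * G = 1 - G := by
    rw [← hG]; noncomm_ring
  have key : (1 - Ab * G * A) * (M * Ab - Ab * Mb) * G
        - Ab * G * (Mb * A - A * M) * (Ab * G) =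
      M * Ab * G - Ab * Mb * G + Ab * (G * A * Ab) * Mb * G
        - Ab * G * Mb * (A * Ab * G) := by
    noncomm_ring
  rw [key, h1, h2]
  noncomm_ring

/-- The bilinear form `v X u` of the dressed matrix `X = Ā(1 + AĀ)⁻¹` between resolvent vectors
is, after multiplication by the sum of the spectral parameters, a kernel of rank two. -/
lemma dotProduct_resolvent
    (hA : diagonal mb * A - A * diagonal m = vecMulVec αv av)
    (hAb : diagonal m * Ab - Ab * diagonal mb = vecMulVec αb ab)
    (hG : (1 + A * Ab) * G = 1) (hG' : G * (1 + A * Ab) = 1)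
    {v u : n → ℝ} {η ζ : ℝ}
    (hv : v ᵥ* diagonal m = av - η • v) (hu : diagonal mb *ᵥ u = αv + ζ • u) :
    1 - (η + ζ) * (v ⬝ᵥ (Ab * G) *ᵥ u) =
      (1 + v ⬝ᵥ (Ab * G) *ᵥ αv) * (1 - av ⬝ᵥ (Ab * G) *ᵥ u) +
        (v ⬝ᵥ (1 - Ab * G * A) *ᵥ αb) * (ab ⬝ᵥ G *ᵥ u) := by
  have h := sylvester_resolvent hA hAb hG hG'
  have h' := congrArg (fun Y : Matrix n n ℝ => v ⬝ᵥ Y *ᵥ u) h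
  have rank_one : ∀ (B D : Matrix n n ℝ) (x y : n → ℝ),
      v ⬝ᵥ (B * vecMulVec x y * D) *ᵥ u = (v ⬝ᵥ B *ᵥ x) * (y ⬝ᵥ D *ᵥ u) := by
    intro B D x y
    rw [← mulVec_mulVec, ← mulVec_mulVec, vecMulVec_mulVec]
    simp [mulVec_smul, mul_comm]
  have left : v ⬝ᵥ (diagonal m * (Ab * G)) *ᵥ u =
      av ⬝ᵥ (Ab * G) *ᵥ u - η * (v ⬝ᵥ (Ab * G) *ᵥ u) := by
    rw [← mulVec_mulVec, dotProduct_mulVec v, hv, sub_dotProduct, smul_dotProduct, smul_eq_mul]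
  have right : v ⬝ᵥ (Ab * G * diagonal mb) *ᵥ u =
      v ⬝ᵥ (Ab * G) *ᵥ αv + ζ * (v ⬝ᵥ (Ab * G) *ᵥ u) := by
    rw [← mulVec_mulVec, hu, mulVec_add, mulVec_smul, dotProduct_add, dotProduct_smul,
      smul_eq_mul]
  simp only [sub_mulVec, dotProduct_sub, rank_one, left, right] at h' ⊢
  linear_combination h'

end RankOneSylvester

/-- `r` is the family of coefficients in the partial fraction expansion of
`∏ⱼ (x - zⱼ) / (x + zⱼ)`; `sum_sq` is the derivative of the expansion at `x = zᵢ`. -/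
structure IsPartialFraction {ι : Type*} [Fintype ι] (z r : ι → ℝ) : Prop where
  prod_eq : ∀ x, (∀ j, x + z j ≠ 0) →
    ∏ j, (x - z j) / (x + z j) = 1 - ∑ j, r j / (x + z j)
  sum_sq : ∀ i, ∑ j, r i * r j / (z i + z j) ^ 2 = 1

namespace IsPartialFraction

variable {ι : Type*} [Fintype ι] {z r : ι → ℝ}

lemma sum_eq_one (hr : IsPartialFraction z r) (hz : ∀ i j, z i + z j ≠ 0) (i : ι) :
    ∑ j, r j / (z i + z j) = 1 := by
  have h := hr.prod_eq (z i) (hz i)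
  rw [Finset.prod_eq_zero (Finset.mem_univ i) (by simp)] at h
  linarith

lemma prod_eq_add (hr : IsPartialFraction z r) {x : ℝ} (hx : ∀ j, x - z j ≠ 0) :
    ∏ j, (x + z j) / (x - z j) = 1 + ∑ j, r j / (x - z j) := by
  have h := hr.prod_eq (-x) fun j => by
    have := hx j
    contrapose! this
    linarith
  have h1 : ∀ j, (-x - z j) / (-x + z j) = (x + z j) / (x - z j) := fun j => by
    rw [← neg_div_neg_eq]; congr 1 <;> ring
  have h2 : ∀ j, r j / (-x + z j) = -(r j / (x - z j)) := fun j => by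
    rw [← div_neg]; congr 1; ring
  simpa only [h1, h2, Finset.sum_neg_distrib, sub_neg_eq_add] using h

lemma prod_div_eq (hr : IsPartialFraction z r) (hz : ∀ i j, z i + z j ≠ 0) {x : ℝ}
    (hx : ∀ j, x - z j ≠ 0) (j : ι) (hxj : x + z j ≠ 0) :
    (∏ i, (x + z i) / (x - z i)) / (x + z j) =
      ∑ i, r i / ((z i + z j) * (x - z i)) := by
  rw [hr.prod_eq_add hx, div_eq_iff hxj, ← hr.sum_eq_one hz j, ← Finset.sum_add_distrib,
    Finset.sum_mul]
  refine Finset.sum_congr rfl fun i _ => ?_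
  have := hz i j
  have := hz j i
  have := hx i
  field_simp
  ring

lemma cauchy_inv [DecidableEq ι] (hr : IsPartialFraction z r) (hz : ∀ i j, z i + z j ≠ 0)
    (hinj : Function.Injective z) :
    (of fun i j => r i * r j / (z i + z j)) * (of fun i j => 1 / (z i + z j)) =
      (1 : Matrix ι ι ℝ) := by
  ext i l
  rw [mul_apply]
  simp only [of_apply]
  rcases eq_or_ne i l with rfl | hil
  · rw [one_apply_eq]
    refine Eq.trans ?_ (hr.sum_sq i)
    refine Finset.sum_congr rfl fun j _ => ?_
    rw [add_comm (z j), div_mul_div_comm, mul_one, sq]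
  · have hil' : z l - z i ≠ 0 := sub_ne_zero.2 fun h => hil (hinj h).symm
    have h : ∀ j, r i * r j / (z i + z j) * (1 / (z j + z l)) =
        r i / (z l - z i) * (r j / (z i + z j) - r j / (z l + z j)) := fun j => by
      have := hz i j
      have := hz j l
      have := hz l j
      field_simp
      ring
    rw [one_apply_ne hil]
    simp only [h]
    rw [← Finset.mul_sum, Finset.sum_sub_distrib, hr.sum_eq_one hz, hr.sum_eq_one hz, sub_self,
      mul_zero]

end IsPartialFraction

section Determinant

variable {n ι : Type*} [Fintype n] [DecidableEq n] [Fintype ι]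
  {m mb αv av : n → ℝ} {A Ab G : Matrix n n ℝ} {z r : ι → ℝ}

/-- Conjugating `A` by the diagonal factors is a perturbation whose rank is the number of
spectral parameters. -/
lemma diagonal_mul_mul_diagonal_eq
    (hA : diagonal mb * A - A * diagonal m = vecMulVec αv av)
    (hr : IsPartialFraction z r) (hz : ∀ i j, z i + z j ≠ 0)
    (hm : ∀ k j, m k + z j ≠ 0) (hmb : ∀ k j, mb k + z j ≠ 0) (hmb' : ∀ k j, mb k - z j ≠ 0) :
    diagonal (fun k => ∏ j, (mb k + z j) / (mb k - z j)) * A *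
        diagonal (fun k => ∏ j, (m k - z j) / (m k + z j)) =
      A - (of fun k i => αv k / (mb k - z i)) * (of fun i j => r i * r j / (z i + z j)) *
        (of fun j k => av k / (m k + z j)) := by
  ext k l
  have hkl : mb k * A k l - A k l * m l = αv k * av l := by
    simpa [vecMulVec_apply] using congrFun (congrFun hA k) l
  rw [Matrix.sub_apply, mul_diagonal, diagonal_mul, mul_apply]
  simp only [mul_apply, of_apply]
  set B := ∏ j, (mb k + z j) / (mb k - z j) with hB
  have inv : B * ∏ j, (mb k - z j) / (mb k + z j) = 1 := by
    rw [hB, ← Finset.prod_mul_distrib]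
    refine Finset.prod_eq_one fun j _ => ?_
    have := hmb k j
    have := hmb' k j
    field_simp
  have shift : A k l * (1 - ∑ j, r j / (m l + z j)) =
      A k l * (1 - ∑ j, r j / (mb k + z j)) -
        ∑ j, αv k * av l * r j / ((mb k + z j) * (m l + z j)) := by
    have : ∑ j, αv k * av l * r j / ((mb k + z j) * (m l + z j)) =
        A k l * ∑ j, r j / (m l + z j) - A k l * ∑ j, r j / (mb k + z j) := by
      rw [Finset.mul_sum, Finset.mul_sum, ← Finset.sum_sub_distrib]
      refine Finset.sum_congr rfl fun j _ => ?_
      have := hm l j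
      have := hmb k j
      rw [← hkl]
      field_simp
      ring
    rw [this]
    ring
  have cols : ∀ j, (∑ i, αv k / (mb k - z i) * (r i * r j / (z i + z j))) *
      (av l / (m l + z j)) = B * (αv k * av l * r j / ((mb k + z j) * (m l + z j))) := by
    intro j
    have h := hr.prod_div_eq hz (hmb' k) j (hmb k j)
    rw [← hB] at h
    have e : ∑ i, αv k / (mb k - z i) * (r i * r j / (z i + z j)) =
        αv k * r j * (B / (mb k + z j)) := by
      rw [h, Finset.mul_sum]
      refine Finset.sum_congr rfl fun i _ => ?_
      have := hmb' k i
      have := hz i j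
      field_simp
    rw [e]
    have := hm l j
    have := hmb k j
    field_simp
  simp only [cols]
  rw [← Finset.mul_sum, hr.prod_eq _ (hm l), mul_assoc, shift, ← hr.prod_eq _ (hmb k)]
  linear_combination A k l * inv

/-- The ratio of the shifted and unshifted tau-functions as a ratio of Cauchy-like
determinants. -/
lemma det_cauchy_mul_tau [DecidableEq ι]
    (hA : diagonal mb * A - A * diagonal m = vecMulVec αv av)
    (hr : IsPartialFraction z r) (hz : ∀ i j, z i + z j ≠ 0) (hinj : Function.Injective z)
    (hm : ∀ k j, m k + z j ≠ 0) (hmb : ∀ k j, mb k + z j ≠ 0) (hmb' : ∀ k j, mb k - z j ≠ 0)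
    (hG : G * (1 + A * Ab) = 1) :
    (of fun i j => 1 / (z i + z j)).det *
        (1 + A * diagonal (fun k => ∏ j, (m k - z j) / (m k + z j)) * Ab *
          diagonal (fun k => ∏ j, (mb k + z j) / (mb k - z j))).det =
      (1 + A * Ab).det *
        (of fun i j => (1 - (z i + z j) *
          ((fun k => av k / (m k + z i)) ⬝ᵥ (Ab * G) *ᵥ fun k => αv k / (mb k - z j))) /
            (z i + z j)).det := by
  set C : Matrix ι ι ℝ := of fun i j => 1 / (z i + z j) with hC
  set W : Matrix ι ι ℝ := of fun i j => r i * r j / (z i + z j) with hW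
  set U : Matrix n ι ℝ := of fun k i => αv k / (mb k - z i) with hU
  set V : Matrix ι n ℝ := of fun j k => av k / (m k + z j) with hV
  have hWC : W * C = 1 := hr.cauchy_inv hz hinj
  have hF : (of fun i j => (1 - (z i + z j) *
      ((fun k => av k / (m k + z i)) ⬝ᵥ (Ab * G) *ᵥ fun k => αv k / (mb k - z j))) /
        (z i + z j)) = C - V * (Ab * G) * U := by
    ext i j
    have hVU : (V * (Ab * G) * U) i j =
        (fun k => av k / (m k + z i)) ⬝ᵥ (Ab * G) *ᵥ fun k => αv k / (mb k - z j) := by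
      rw [Matrix.mul_assoc]
      rfl
    rw [Matrix.sub_apply, hVU, of_apply, hC, of_apply]
    have := hz i j
    field_simp
  have hsplit : 1 + (A - U * W * V) * Ab = (1 - U * (W * (V * (Ab * G)))) * (1 + A * Ab) := by
    calc 1 + (A - U * W * V) * Ab = 1 + A * Ab - U * W * V * Ab * 1 := by noncomm_ring
      _ = 1 + A * Ab - U * W * V * Ab * (G * (1 + A * Ab)) := by rw [hG]
      _ = _ := by simp only [Matrix.mul_assoc, Matrix.sub_mul, Matrix.one_mul]
  rw [hF, Matrix.mul_assoc (A * _), Matrix.mul_assoc A, ← Matrix.mul_assoc _ Ab,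
    ← Matrix.mul_assoc A, det_one_add_mul_comm, ← Matrix.mul_assoc, ← Matrix.mul_assoc,
    diagonal_mul_mul_diagonal_eq hA hr hz hm hmb hmb', hsplit, det_mul, det_one_sub_mul_comm,
    ← mul_assoc, ← det_mul, mul_comm]
  congr 2
  rw [Matrix.mul_sub, Matrix.mul_one, Matrix.mul_assoc W, ← Matrix.mul_assoc C W,
    mul_eq_one_comm.1 hWC, Matrix.one_mul]

end Determinant

lemma isPartialFraction_one (a : ℝ) (ha : a ≠ 0) :
    IsPartialFraction ![a] ![2 * a] := by
  constructor
  · intro x hx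
    have := hx 0
    simp at this ⊢
    field_simp
    ring
  · intro i
    fin_cases i
    simp
    field_simp
    ring

lemma isPartialFraction_two (a b : ℝ) (ha : a ≠ 0) (hb : b ≠ 0)
    (hab : a - b ≠ 0) (hab' : a + b ≠ 0) :
    IsPartialFraction ![a, b]
      ![2 * a * ((a + b) / (a - b)), -2 * b * ((a + b) / (a - b))] := by
  have hba : b + a ≠ 0 := by rwa [add_comm]
  constructor
  · intro x hx
    have h0 := hx 0
    have h1 := hx 1
    simp [Fin.prod_univ_succ, Fin.sum_univ_succ] at h0 h1 ⊢
    field_simp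
    ring
  · intro i
    fin_cases i <;> simp [Fin.sum_univ_succ, ← two_mul] <;> field_simp <;> ring

lemma isPartialFraction_three (a b c : ℝ) (ha : a ≠ 0) (hb : b ≠ 0) (hc : c ≠ 0)
    (hab : a - b ≠ 0) (hac : a - c ≠ 0) (hbc : b - c ≠ 0)
    (hab' : a + b ≠ 0) (hac' : a + c ≠ 0) (hbc' : b + c ≠ 0) :
    IsPartialFraction ![a, b, c]
      ![2 * a * ((a + b) / (a - b)) * ((a + c) / (a - c)),
        -2 * b * ((a + b) / (a - b)) * ((b + c) / (b - c)),
        2 * c * ((a + c) / (a - c)) * ((b + c) / (b - c))] := by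
  have hba : b + a ≠ 0 := by rwa [add_comm]
  have hca : c + a ≠ 0 := by rwa [add_comm]
  have hcb : c + b ≠ 0 := by rwa [add_comm]
  constructor
  · intro x hx
    have h0 := hx 0
    have h1 := hx 1
    have h2 := hx 2
    simp [Fin.prod_univ_succ, Fin.sum_univ_succ] at h0 h1 h2 ⊢
    field_simp
    ring
  · intro i
    fin_cases i <;> simp [Fin.sum_univ_succ, ← two_mul] <;> field_simp <;> ring

lemma inv_diagonal_of_ne_zero {n : Type*} [Fintype n] [DecidableEq n] {d : n → ℝ}
    (hd : ∀ k, d k ≠ 0) : (diagonal d)⁻¹ = diagonal fun k => (d k)⁻¹ :=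
  inv_eq_right_inv (by
    rw [diagonal_mul_diagonal, ← diagonal_one]
    congr 1
    ext k
    exact mul_inv_cancel₀ (hd k))

lemma Hmat_eq_diagonal {N : ℕ} {m : Fin N → ℝ} {ζ : ℝ} (h : ∀ k, m k + ζ ≠ 0) :
    Hmat m ζ = diagonal fun k => (m k - ζ) / (m k + ζ) := by
  rw [Hmat, smul_one_eq_diagonal, diagonal_add, diagonal_sub, inv_diagonal_of_ne_zero h,
    diagonal_mul_diagonal]
  rfl

lemma Hbmat_eq_diagonal {N : ℕ} {mb : Fin N → ℝ} {ζ : ℝ} (h : ∀ k, mb k - ζ ≠ 0) :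
    Hbmat mb ζ = diagonal fun k => (mb k + ζ) / (mb k - ζ) := by
  rw [Hbmat, smul_one_eq_diagonal, diagonal_add, diagonal_sub, inv_diagonal_of_ne_zero h,
    diagonal_mul_diagonal]
  rfl

lemma tauL_ofFn {N l : ℕ} {m mb : Fin N → ℝ} (A Ab : Matrix (Fin N) (Fin N) ℝ)
    {z : Fin l → ℝ} (hm : ∀ k j, m k + z j ≠ 0) (hmb : ∀ k j, mb k - z j ≠ 0) :
    tauL m mb A Ab (List.ofFn z) =
      (1 + A * diagonal (fun k => ∏ j, (m k - z j) / (m k + z j)) * Ab *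
        diagonal (fun k => ∏ j, (mb k + z j) / (mb k - z j))).det := by
  have prod_diagonal : ∀ {l : ℕ} (d : Fin l → Fin N → ℝ),
      (List.ofFn fun j => diagonal (d j)).prod = diagonal fun k => ∏ j, d j k := by
    intro l d
    induction l with
    | zero => simp
    | succ l ih =>
      rw [List.ofFn_succ, List.prod_cons, ih, diagonal_mul_diagonal]
      simp only [Fin.prod_univ_succ]
  have h1 : (Hmat m ∘ z) = fun j => diagonal fun k => (m k - z j) / (m k + z j) :=
    funext fun j => Hmat_eq_diagonal fun k => hm k j
  have h2 : (Hbmat mb ∘ z) = fun j => diagonal fun k => (mb k + z j) / (mb k - z j) :=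
    funext fun j => Hbmat_eq_diagonal fun k => hmb k j
  rw [tauL, List.map_ofFn, List.map_ofFn, h1, h2, prod_diagonal, prod_diagonal]

/-- All shifted tau-functions are Cauchy-like determinants built from one kernel of rank two. -/
lemma exists_rank_two_kernel {N : ℕ} {m mb αv αb av ab : Fin N → ℝ}
    {A Ab : Matrix (Fin N) (Fin N) ℝ}
    (hA : diagonal mb * A - A * diagonal m = vecMulVec αv av)
    (hAb : diagonal m * Ab - Ab * diagonal mb = vecMulVec αb ab)
    (hG : IsUnit (1 + A * Ab)) :
    ∃ x y s t : ℝ → ℝ, ∀ (l : ℕ) (z r : Fin l → ℝ), IsPartialFraction z r →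
      (∀ i j, z i + z j ≠ 0) → Function.Injective z → (∀ k j, m k + z j ≠ 0) →
      (∀ k j, mb k + z j ≠ 0) → (∀ k j, mb k - z j ≠ 0) →
      (of fun i j => 1 / (z i + z j)).det * tauL m mb A Ab (List.ofFn z) =
        tauL m mb A Ab [] *
          (of fun i j => (x (z i) * y (z j) + s (z i) * t (z j)) / (z i + z j)).det := by
  obtain ⟨⟨K, G, h1, h2⟩, rfl : K = _⟩ := hG
  refine ⟨fun η => 1 + (fun k => av k / (m k + η)) ⬝ᵥ (Ab * G) *ᵥ αv,
    fun ζ => 1 - av ⬝ᵥ (Ab * G) *ᵥ fun k => αv k / (mb k - ζ),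
    fun η => (fun k => av k / (m k + η)) ⬝ᵥ (1 - Ab * G * A) *ᵥ αb,
    fun ζ => ab ⬝ᵥ G *ᵥ fun k => αv k / (mb k - ζ),
    fun l z r hr hz hinj hm hmb hmb' => ?_⟩
  rw [tauL_ofFn A Ab hm hmb', det_cauchy_mul_tau hA hr hz hinj hm hmb hmb' h2]
  congr 2
  · simp
  · ext i j
    rw [of_apply, of_apply, dotProduct_resolvent hA hAb h1 h2]
    · ext k
      have := hm k i
      simp only [vecMul_diagonal, Pi.sub_apply, Pi.smul_apply, smul_eq_mul]
      field_simp
      ring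
    · ext k
      have := hmb' k j
      simp only [mulVec_diagonal, Pi.add_apply, Pi.smul_apply, smul_eq_mul]
      field_simp
      ring

theorem tau_satisfies_Miwa_discrete_BKP
    {N : ℕ} (hN : 1 ≤ N) (m mb : Fin N → ℝ)
    (αv αb av ab : Fin N → ℝ)
    (A Ab : Matrix (Fin N) (Fin N) ℝ)
    (hA : Matrix.diagonal mb * A - A * Matrix.diagonal m = Matrix.vecMulVec αv av)
    (hAb : Matrix.diagonal m * Ab - Ab * Matrix.diagonal mb = Matrix.vecMulVec αb ab)
    (α β γ : ℝ)
    (hαβ : α ≠ β) (hαγ : α ≠ γ) (hβγ : β ≠ γ)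
    (hα : α ≠ 0) (hβ : β ≠ 0) (hγ : γ ≠ 0)
    (hαβ' : α + β ≠ 0) (hαγ' : α + γ ≠ 0) (hβγ' : β + γ ≠ 0)
    (hm : ∀ k, m k ≠ α ∧ m k ≠ -α ∧ m k ≠ β ∧ m k ≠ -β ∧ m k ≠ γ ∧ m k ≠ -γ)
    (hmb : ∀ k, mb k ≠ α ∧ mb k ≠ -α ∧ mb k ≠ β ∧ mb k ≠ -β ∧ mb k ≠ γ ∧ mb k ≠ -γ)
    (hG : IsUnit ((1 : Matrix (Fin N) (Fin N) ℝ) + A * Ab)) :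
    tauL m mb A Ab [] * tauL m mb A Ab [α, β, γ] =
      ((α + β) / (α - β)) * ((α + γ) / (α - γ)) *
        tauL m mb A Ab [α] * tauL m mb A Ab [β, γ] +
      ((β + α) / (β - α)) * ((β + γ) / (β - γ)) *
        tauL m mb A Ab [β] * tauL m mb A Ab [α, γ] +
      ((γ + α) / (γ - α)) * ((γ + β) / (γ - β)) *
        tauL m mb A Ab [γ] * tauL m mb A Ab [α, β] := by
  obtain ⟨x, y, s, t, h⟩ := exists_rank_two_kernel hA hAb hG
  obtain ⟨g, hg⟩ : ∃ g : ℝ → ℝ → ℝ, ∀ η ζ, g η ζ = x η * y ζ + s η * t ζ := ⟨_, fun _ _ => rfl⟩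
  simp only [← hg] at h
  have hβα' : β + α ≠ 0 := by rwa [add_comm]
  have hγα' : γ + α ≠ 0 := by rwa [add_comm]
  have hγβ' : γ + β ≠ 0 := by rwa [add_comm]
  have dαβ := sub_ne_zero.2 hαβ
  have dαγ := sub_ne_zero.2 hαγ
  have dβγ := sub_ne_zero.2 hβγ
  have nm : ∀ ζ ∈ ({α, β, γ} : Set ℝ), ∀ k, m k + ζ ≠ 0 ∧ mb k + ζ ≠ 0 ∧ mb k - ζ ≠ 0 := by
    have aux : ∀ {u v : ℝ}, u ≠ -v → u + v ≠ 0 := fun h h' => h (eq_neg_of_add_eq_zero_left h')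
    rintro ζ (rfl | rfl | rfl) k <;> obtain ⟨_, h2, _, h4, _, h6⟩ := hm k <;>
      obtain ⟨g1, g2, g3, g4, g5, g6⟩ := hmb k <;>
      exact ⟨aux ‹_›, aux ‹_›, sub_ne_zero.2 ‹_›⟩
  have one : ∀ a ∈ ({α, β, γ} : Set ℝ), a ≠ 0 →
      tauL m mb A Ab [a] = tauL m mb A Ab [] * g a a := by
    intro a ha ha0
    have e := h 1 ![a] _ (isPartialFraction_one a ha0) (by simpa using ha0)
      (Function.injective_of_subsingleton _) (by simpa using fun k => (nm a ha k).1)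
      (by simpa using fun k => (nm a ha k).2.1) (by simpa using fun k => (nm a ha k).2.2)
    simp at e
    field_simp at e
    linear_combination e
  have two : ∀ a ∈ ({α, β, γ} : Set ℝ), ∀ b ∈ ({α, β, γ} : Set ℝ), a ≠ 0 → b ≠ 0 →
      a - b ≠ 0 → a + b ≠ 0 → tauL m mb A Ab [a, b] = tauL m mb A Ab [] *
        ((a + b) ^ 2 * (g a a * g b b) -
          4 * a * b * (g a b * g b a)) / (a - b) ^ 2 := by
    intro a ha b hb ha0 hb0 hab hab'
    have hba' : b + a ≠ 0 := by rwa [add_comm]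
    have e := h 2 ![a, b] _ (isPartialFraction_two a b ha0 hb0 hab hab')
      (by simp [Fin.forall_fin_succ, *])
      (by
        intro i j
        fin_cases i <;> fin_cases j <;> simp [sub_ne_zero.1 hab, (sub_ne_zero.1 hab).symm])
      (fun k => by simp [Fin.forall_fin_succ, nm a ha k, nm b hb k])
      (fun k => by simp [Fin.forall_fin_succ, nm a ha k, nm b hb k])
      (fun k => by simp [Fin.forall_fin_succ, nm a ha k, nm b hb k])
    have hC : (of fun i j => 1 / (![a, b] i + ![a, b] j)).det =
        (a - b) ^ 2 / (4 * a * b * (a + b) ^ 2) := by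
      simp [det_fin_two, ← two_mul, add_comm b a]
      field_simp
      ring
    rw [hC] at e
    simp [det_fin_two, ← two_mul, add_comm b a] at e
    field_simp at e ⊢
    linear_combination e / 4
  have three : tauL m mb A Ab [α, β, γ] * ((α - β) * (α - γ) * (β - γ)) ^ 2 =
      tauL m mb A Ab [] *
        (((α + β) * (α + γ) * (β + γ)) ^ 2 * (g α α * g β β * g γ γ) +
          8 * α * β * γ * ((α + β) * (α + γ) * (β + γ)) *
            (g α β * g β γ * g γ α + g α γ * g γ β * g β α) -
          4 * ((α + β) * (α + γ)) ^ 2 * β * γ * (g α α * (g β γ * g γ β)) -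
          4 * ((α + β) * (β + γ)) ^ 2 * α * γ * (g β β * (g α γ * g γ α)) -
          4 * ((α + γ) * (β + γ)) ^ 2 * α * β * (g γ γ * (g α β * g β α))) := by
    have e := h 3 ![α, β, γ] _ (isPartialFraction_three α β γ hα hβ hγ dαβ dαγ dβγ hαβ' hαγ' hβγ')
      (by simp [Fin.forall_fin_succ, *])
      (by
        intro i j
        fin_cases i <;> fin_cases j <;> simp [hαβ, hαγ, hβγ, hαβ.symm, hαγ.symm, hβγ.symm])
      (fun k => by simp [Fin.forall_fin_succ, nm α, nm β, nm γ])
      (fun k => by simp [Fin.forall_fin_succ, nm α, nm β, nm γ])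
      (fun k => by simp [Fin.forall_fin_succ, nm α, nm β, nm γ])
    have hC : (of fun i j => 1 / (![α, β, γ] i + ![α, β, γ] j)).det =
        ((α - β) * (α - γ) * (β - γ)) ^ 2 /
          (8 * α * β * γ * ((α + β) * (α + γ) * (β + γ)) ^ 2) := by
      simp [det_fin_three, ← two_mul, add_comm β α, add_comm γ α, add_comm γ β]
      field_simp
      ring
    rw [hC] at e
    simp [det_fin_three, ← two_mul, add_comm β α, add_comm γ α, add_comm γ β] at e
    field_simp at e ⊢
    linear_combination e / 8
  have hdet : g α α * g β β * g γ γ + g α β * g β γ * g γ α + g α γ * g γ β * g β α -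
      g α α * (g β γ * g γ β) - g β β * (g α γ * g γ α) - g γ γ * (g α β * g β α) = 0 := by
    simp only [hg]
    ring
  rw [← eq_div_iff (by positivity)] at three
  rw [three, one α (by simp) hα, one β (by simp) hβ, one γ (by simp) hγ,
    two β (by simp) γ (by simp) hβ hγ dβγ hβγ', two α (by simp) γ (by simp) hα hγ dαγ hαγ',
    two α (by simp) β (by simp) hα hβ dαβ hαβ', ← neg_sub α β, ← neg_sub α γ, ← neg_sub β γ]
  generalize tauL m mb A Ab [] = T
  linear_combination (norm := skip) T ^ 2 * (8 * α * β * γ * ((α + β) * (α + γ) * (β + γ))) /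
    ((α - β) * (α - γ) * (β - γ)) ^ 2 * hdet
  field_simp
  ring

end
end
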